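/- (Range-averaged privacy under the pseudo posterior mechanism.) Let Θ be a measurable space equipped with a prior measure ξ, let n ≥ 1, and for each record i ∈ {1,…,n} let p_i : Θ → ℝ be measurable with p_i(θ) > 0 for all θ (the likelihood value p(x_i | θ)), and let α_i ∈ [0,1] and λ_i ∈ [0,1] be given weights. Define the range-averaged pseudo log-likelihood L(θ) = Σ_{i=1}^{n} (1−λ_i)·α_i·log p_i(θ), and for a fixed index j the adjacent pseudo log-likelihood L'(θ) = Σ_{i≠j} (1−λ_i)·α_i·log p_i(θ). Let Δ ≥ 0 satisfy |(1−λ_i)·α_i·log p_i(θ)| ≤ Δ for all θ ∈ Θ and all i (so Δ is an upper bound for the range-averaged sensitivity Δ_{α,λ,x}). If 0 < ∫_Θ exp(L) dξ < ∞ and 0 < ∫_Θ exp(L') dξ < ∞, then for every measurable set B ⊆ Θ, (∫_B exp(L) dξ)/(∫_Θ exp(L) dξ) ≤ exp(2Δ) · (∫_B exp(L') dξ)/(∫_Θ exp(L') dξ); i.e., the range-averaged pseudo posterior ξ^{λ^c α}(· | x) has local privacy guarantee 2Δ_{α,λ,x}. -/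

import Mathlib

open MeasureTheory Real

/-- If `f ≤ g + Δ` pointwise, then `exp f` integrates to at most `exp Δ` times the integral of
`exp g`. -/
theorem integral_exp_le_exp_mul_integral_exp {Θ : Type*} [MeasurableSpace Θ] {μ : Measure Θ}
    {f g : Θ → ℝ} {Δ : ℝ} (hfg : ∀ θ, f θ ≤ g θ + Δ)
    (hf : Integrable (fun θ => exp (f θ)) μ) (hg : Integrable (fun θ => exp (g θ)) μ) :
    ∫ θ, exp (f θ) ∂μ ≤ exp Δ * ∫ θ, exp (g θ) ∂μ := by
  rw [← integral_const_mul]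
  refine integral_mono hf (hg.const_mul _) fun θ => ?_
  simp only [← exp_add]
  exact exp_le_exp.mpr (by linarith [hfg θ])

/-- Log-densities at uniform distance at most `Δ` normalise to probabilities whose ratio is at most
`exp (2 * Δ)`. -/
theorem setIntegral_exp_div_le_of_abs_sub_le {Θ : Type*} [MeasurableSpace Θ] {μ : Measure Θ}
    {f g : Θ → ℝ} {Δ : ℝ} (hfg : ∀ θ, |f θ - g θ| ≤ Δ)
    (hf : Integrable (fun θ => exp (f θ)) μ) (hg : Integrable (fun θ => exp (g θ)) μ)
    (hfpos : 0 < ∫ θ, exp (f θ) ∂μ) (hgpos : 0 < ∫ θ, exp (g θ) ∂μ) (B : Set Θ) :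
    (∫ θ in B, exp (f θ) ∂μ) / (∫ θ, exp (f θ) ∂μ) ≤
      exp (2 * Δ) * ((∫ θ in B, exp (g θ) ∂μ) / (∫ θ, exp (g θ) ∂μ)) := by
  have hnum : ∫ θ in B, exp (f θ) ∂μ ≤ exp Δ * ∫ θ in B, exp (g θ) ∂μ :=
    integral_exp_le_exp_mul_integral_exp
      (fun θ => by linarith [(abs_le.mp (hfg θ)).2]) hf.restrict hg.restrict
  have hden : ∫ θ, exp (g θ) ∂μ ≤ exp Δ * ∫ θ, exp (f θ) ∂μ :=
    integral_exp_le_exp_mul_integral_exp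
      (fun θ => by linarith [(abs_le.mp (hfg θ)).1]) hg hf
  have hB : 0 ≤ ∫ θ in B, exp (g θ) ∂μ := integral_nonneg fun θ => (exp_pos _).le
  rw [← mul_div_assoc, div_le_div_iff₀ hfpos hgpos]
  calc (∫ θ in B, exp (f θ) ∂μ) * ∫ θ, exp (g θ) ∂μ
      ≤ (exp Δ * ∫ θ in B, exp (g θ) ∂μ) * (exp Δ * ∫ θ, exp (f θ) ∂μ) :=
        mul_le_mul hnum hden hgpos.le (by positivity)
    _ = exp (2 * Δ) * (∫ θ in B, exp (g θ) ∂μ) * ∫ θ, exp (f θ) ∂μ := by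
        rw [two_mul, exp_add]; ring

/-- Range-averaged privacy under the pseudo posterior mechanism: with
pseudo log-likelihood `L θ = ∑ i, (1 - λ i) * α i * log (p i θ)` and adjacent
pseudo log-likelihood `L'` omitting record `j`, a uniform bound `Δ` on each
sensitive contribution `|(1 - λ i) * α i * log (p i θ)|` yields a local privacy
guarantee `2Δ` for the range-averaged pseudo posterior. -/
theorem range_averaged_privacy_pseudo_posterior
    {Θ : Type*} [MeasurableSpace Θ] (ξ : Measure Θ)
    (n : ℕ) (hn : 1 ≤ n) (p : Fin n → Θ → ℝ)
    (hpmeas : ∀ i, Measurable (p i)) (hppos : ∀ i θ, 0 < p i θ)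
    (α lam : Fin n → ℝ)
    (hα : ∀ i, α i ∈ Set.Icc (0 : ℝ) 1) (hlam : ∀ i, lam i ∈ Set.Icc (0 : ℝ) 1)
    (j : Fin n) (Δ : ℝ) (hΔ : 0 ≤ Δ)
    (hsens : ∀ θ : Θ, ∀ i, |(1 - lam i) * α i * Real.log (p i θ)| ≤ Δ)
    (L L' : Θ → ℝ)
    (hLdef : ∀ θ, L θ = ∑ i, (1 - lam i) * α i * Real.log (p i θ))
    (hL'def : ∀ θ, L' θ = ∑ i ∈ Finset.univ.erase j, (1 - lam i) * α i * Real.log (p i θ))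
    (hint : Integrable (fun θ => exp (L θ)) ξ)
    (hint' : Integrable (fun θ => exp (L' θ)) ξ)
    (hpos : 0 < ∫ θ, exp (L θ) ∂ξ)
    (hpos' : 0 < ∫ θ, exp (L' θ) ∂ξ) :
    ∀ B : Set Θ, MeasurableSet B →
      (∫ θ in B, exp (L θ) ∂ξ) / (∫ θ, exp (L θ) ∂ξ) ≤
        exp (2 * Δ) * ((∫ θ in B, exp (L' θ) ∂ξ) / (∫ θ, exp (L' θ) ∂ξ)) := by
  intro B _
  refine setIntegral_exp_div_le_of_abs_sub_le (fun θ => ?_) hint hint' hpos hpos' B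
  rw [hLdef, hL'def, ← Finset.add_sum_erase _ _ (Finset.mem_univ j), add_sub_cancel_right]
  exact hsens θ j
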